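/- (Local testing estimate, Lemma 3.1) Let 0 ≤ α < 2n, 1 < p₁, p₂ < ∞, 1/p = 1/p₁ + 1/p₂, 1/q = 1/p − α/n, and q ≥ p₂. Let w₁, w₂, v be weights, σ_i = w_i^{1-p_i'}, and suppose the Sawyer testing constant [w⃗,v]_{S} := sup_Q (∫_Q ℳ_α(σ₁1_Q, σ₂1_Q)^q v dx)^{1/q} / (σ₁(Q)^{1/p₁} σ₂(Q)^{1/p₂}) is finite. Then for any dyadic grid 𝒟, any R ∈ 𝒟 and any f supported in R, ‖1_R ℳ^𝒟_α(1_R σ₁, f σ₂)‖_{L^q(v)} ≤ C [w⃗,v]_{S} σ₁(R)^{1/p₁} ‖f‖_{L^{p₂}(σ₂)}. -/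

import Mathlib

open MeasureTheory ENNReal Set
open scoped BigOperators

noncomputable section

abbrev Rn (n : ℕ) := Fin n → ℝ

/-- An axis-parallel half-open cube with corner `c` and side length `l`. -/
def cube {n : ℕ} (c : Rn n) (l : ℝ) : Set (Rn n) :=
  {x | ∀ i, c i ≤ x i ∧ x i < c i + l}

/-- `σ(Q) = ∫_Q σ dx`. -/
def wtI {n : ℕ} (σ : Rn n → ℝ≥0∞) (Q : Set (Rn n)) : ℝ≥0∞ := ∫⁻ x in Q, σ x

/-- `𝔼^σ_Q f = σ(Q)⁻¹ ∫_Q f σ`. -/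
def avgE {n : ℕ} (σ f : Rn n → ℝ≥0∞) (Q : Set (Rn n)) : ℝ≥0∞ :=
  (wtI σ Q)⁻¹ * ∫⁻ x in Q, f x * σ x

/-- The cube `2^{-k}([0,1)ⁿ + m + (-1)^k t)` of the shifted dyadic grid. -/
def gridCube (n : ℕ) (k : ℤ) (m : Fin n → ℤ) (t : Fin n → ℝ) : Set (Rn n) :=
  {x | ∀ i, (2:ℝ) ^ (-k) * ((m i : ℝ) + (-1:ℝ) ^ k * t i) ≤ x i ∧
       x i < (2:ℝ) ^ (-k) * ((m i : ℝ) + (-1:ℝ) ^ k * t i + 1)}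

/-- The shifted dyadic grid `𝒟_t`. -/
def shiftedGrid (n : ℕ) (t : Fin n → ℝ) : Set (Set (Rn n)) :=
  {Q | ∃ (k : ℤ) (m : Fin n → ℤ), Q = gridCube n k m t}

/-- Abstract dyadic grid: cubes of dyadic side lengths, nested or disjoint,
and for each scale the cubes of that side length cover `ℝⁿ`. -/
def IsDyadicGrid {n : ℕ} (𝒟 : Set (Set (Rn n))) : Prop :=
  (∀ Q ∈ 𝒟, ∃ (c : Rn n) (k : ℤ), Q = cube c ((2:ℝ) ^ k)) ∧
  (∀ Q ∈ 𝒟, ∀ R ∈ 𝒟, Q ∩ R = Q ∨ Q ∩ R = R ∨ Q ∩ R = ∅) ∧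
  (∀ k : ℤ, (⋃ Q ∈ {Q | Q ∈ 𝒟 ∧ ∃ c : Rn n, Q = cube c ((2:ℝ) ^ k)}, Q) = univ)

/-- The multilinear fractional maximal operator `ℳ_α`. -/
def MM (n m : ℕ) (α : ℝ) (g : Fin m → Rn n → ℝ≥0∞) (x : Rn n) : ℝ≥0∞ :=
  ⨆ (c : Rn n) (l : ℝ) (_ : 0 < l) (_ : x ∈ cube c l),
    ∏ i, (volume (cube c l) ^ (-(1 - α / ((m : ℝ) * (n : ℝ)))) * ∫⁻ y in cube c l, g i y)

/-- The multilinear fractional maximal operator restricted to a grid `𝒟`. -/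
def MMD (n m : ℕ) (α : ℝ) (𝒟 : Set (Set (Rn n))) (g : Fin m → Rn n → ℝ≥0∞)
    (x : Rn n) : ℝ≥0∞ :=
  ⨆ (Q : Set (Rn n)) (_ : Q ∈ 𝒟) (_ : x ∈ Q),
    ∏ i, (volume Q ^ (-(1 - α / ((m : ℝ) * (n : ℝ)))) * ∫⁻ y in Q, g i y)

/-- The bilinear fractional maximal operator `ℳ_α(g₁,g₂)`. -/
def M2 (n : ℕ) (α : ℝ) (g₁ g₂ : Rn n → ℝ≥0∞) (x : Rn n) : ℝ≥0∞ :=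
  ⨆ (c : Rn n) (l : ℝ) (_ : 0 < l) (_ : x ∈ cube c l),
    (volume (cube c l) ^ (-(1 - α / (2 * (n : ℝ)))) * ∫⁻ y in cube c l, g₁ y) *
      (volume (cube c l) ^ (-(1 - α / (2 * (n : ℝ)))) * ∫⁻ y in cube c l, g₂ y)

/-- The bilinear dyadic fractional maximal operator `ℳ^𝒟_α(g₁,g₂)`. -/
def M2D (n : ℕ) (α : ℝ) (𝒟 : Set (Set (Rn n))) (g₁ g₂ : Rn n → ℝ≥0∞) (x : Rn n) : ℝ≥0∞ :=
  ⨆ (Q : Set (Rn n)) (_ : Q ∈ 𝒟) (_ : x ∈ Q),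
    (volume Q ^ (-(1 - α / (2 * (n : ℝ)))) * ∫⁻ y in Q, g₁ y) *
      (volume Q ^ (-(1 - α / (2 * (n : ℝ)))) * ∫⁻ y in Q, g₂ y)

/-- Sawyer's bilinear testing constant `[w⃗,v]_{S_{P⃗,q}}`. -/
def sawyer2 (n : ℕ) (α p₁ p₂ q : ℝ) (σ₁ σ₂ v : Rn n → ℝ≥0∞) : ℝ≥0∞ :=
  ⨆ (c : Rn n) (l : ℝ) (_ : 0 < l),
    (∫⁻ x in cube c l,
        M2 n α ((cube c l).indicator σ₁) ((cube c l).indicator σ₂) x ^ q * v x) ^ (1/q) /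
      (wtI σ₁ (cube c l) ^ (1/p₁) * wtI σ₂ (cube c l) ^ (1/p₂))

/-- Sawyer's multilinear testing constant. -/
def sawyerM (n m : ℕ) (α q : ℝ) (p : Fin m → ℝ) (σ : Fin m → Rn n → ℝ≥0∞)
    (v : Rn n → ℝ≥0∞) : ℝ≥0∞ :=
  ⨆ (c : Rn n) (l : ℝ) (_ : 0 < l),
    (∫⁻ x in cube c l, MM n m α (fun i => (cube c l).indicator (σ i)) x ^ q * v x) ^ (1/q) /
      ∏ i, wtI (σ i) (cube c l) ^ (1 / p i)

/-- The principal cubes of `f` relative to `σ` inside `Qbar`, generation by generation. -/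
def principalCubes {n : ℕ} (𝒟 : Set (Set (Rn n))) (σ f : Rn n → ℝ≥0∞)
    (Qbar : Set (Rn n)) : ℕ → Set (Set (Rn n))
  | 0 => {Qbar}
  | k + 1 => {G' | G' ∈ 𝒟 ∧ ∃ G ∈ principalCubes 𝒟 σ f Qbar k, G' ⊆ G ∧
      4 * avgE σ f G < avgE σ f G' ∧
      ∀ G'' ∈ 𝒟, G' ⊆ G'' → G'' ⊆ G → 4 * avgE σ f G < avgE σ f G'' → G'' = G'}

lemma cube_sub_le {n : ℕ} (hn : 0 < n) {c c' : Rn n} {l l' : ℝ} (hl' : 0 < l')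
    (h : cube c l ⊆ cube c' l') : l ≤ l' := by
  by_contra hlt
  push Not at hlt
  have h1 : c ∈ cube c' l' := h (fun i => ⟨le_rfl, by linarith⟩)
  have h2 : (fun i => c i + l') ∈ cube c' l' :=
    h (fun i => ⟨by linarith, by linarith⟩)
  have a := (h1 ⟨0, hn⟩).1
  have b := (h2 ⟨0, hn⟩).2
  simp only at b
  linarith

lemma cube_sub_eq {n : ℕ} {c c' : Rn n} {l : ℝ} (hl : 0 < l)
    (h : cube c l ⊆ cube c' l) : cube c l = cube c' l := by
  have h1 : c ∈ cube c' l := h (fun i => ⟨le_rfl, by linarith⟩)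
  have : c = c' := by
    funext i
    by_contra hne
    have hlt : c' i < c i := lt_of_le_of_ne (h1 i).1 (Ne.symm hne)
    have h3 := (h1 i).2
    have h2 : (fun j => c j + (l - (c i - c' i))) ∈ cube c' l :=
      h (fun j => ⟨by linarith, by linarith⟩)
    have b := (h2 i).2
    simp only at b
    linarith
  rw [this]

lemma cube_eq_pi {n : ℕ} (c : Rn n) (l : ℝ) :
    cube c l = Set.pi univ (fun i => Ico (c i) (c i + l)) := by
  ext x; simp [cube, Set.mem_pi]

lemma cube_meas {n : ℕ} (c : Rn n) (l : ℝ) : MeasurableSet (cube c l) := by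
  rw [cube_eq_pi]
  exact MeasurableSet.univ_pi (fun i => measurableSet_Ico)

lemma cube_int {n : ℕ} (c : Rn n) {l : ℝ} (hl : 0 < l) : (interior (cube c l)).Nonempty := by
  rw [cube_eq_pi, interior_pi_set finite_univ]
  refine ⟨fun i => c i + l / 2, fun i _ => ?_⟩
  simp only [interior_Ico, mem_Ioo]
  constructor <;> linarith

lemma two_zpow_pos (k : ℤ) : (0:ℝ) < 2 ^ k := zpow_pos (by norm_num) k

lemma grid_meas {n : ℕ} {𝒟 : Set (Set (Rn n))} (h : IsDyadicGrid 𝒟) {Q : Set (Rn n)}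
    (hQ : Q ∈ 𝒟) : MeasurableSet Q := by
  obtain ⟨c, k, rfl⟩ := h.1 Q hQ
  exact cube_meas _ _

lemma grid_same {n : ℕ} {𝒟 : Set (Set (Rn n))} (h : IsDyadicGrid 𝒟) {Q R : Set (Rn n)}
    (hQ : Q ∈ 𝒟) (hR : R ∈ 𝒟) {x : Rn n} (hxQ : x ∈ Q) (hxR : x ∈ R) : Q ⊆ R ∨ R ⊆ Q := by
  rcases h.2.1 Q hQ R hR with h1 | h1 | h1
  · left; exact inter_eq_left.1 h1
  · right; exact inter_eq_right.1 h1
  · exact absurd (h1 ▸ ⟨hxQ, hxR⟩ : x ∈ (∅ : Set (Rn n))) (by simp)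

lemma grid_countable {n : ℕ} {𝒟 : Set (Set (Rn n))} (h : IsDyadicGrid 𝒟) :
    𝒟.Countable := by
  have : 𝒟 = ⋃ k : ℤ, {Q | Q ∈ 𝒟 ∧ ∃ c : Rn n, Q = cube c ((2:ℝ) ^ k)} := by
    ext Q
    simp only [mem_iUnion, mem_ofPred_eq]
    constructor
    · intro hQ
      obtain ⟨c, k, hk⟩ := h.1 Q hQ
      exact ⟨k, hQ, c, hk⟩
    · rintro ⟨k, hQ, -⟩; exact hQ
  rw [this]
  refine countable_iUnion fun k => ?_
  refine Set.PairwiseDisjoint.countable_of_nonempty_interior (s := id) ?_ ?_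
  · rintro Q ⟨hQ, c, hc⟩ R ⟨hR, c', hc'⟩ hne
    rw [Function.onFun, Set.disjoint_left]
    intro x hxQ hxR
    apply hne
    rcases grid_same h hQ hR hxQ hxR with h1 | h1
    · rw [hc, hc'] at *; exact cube_sub_eq (two_zpow_pos k) h1
    · rw [hc, hc'] at *; exact (cube_sub_eq (two_zpow_pos k) h1).symm
  · rintro Q ⟨hQ, c, rfl⟩
    exact cube_int c (two_zpow_pos k)

/-- Every member of a subfamily of dyadic subcubes of `R` lies in a maximal one. -/
lemma exists_maximal_cube {n : ℕ} (hn : 0 < n) {𝒟 : Set (Set (Rn n))} (h : IsDyadicGrid 𝒟)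
    {R : Set (Rn n)} (hR : R ∈ 𝒟) {F : Set (Set (Rn n))} (hF : ∀ Q ∈ F, Q ∈ 𝒟 ∧ Q ⊆ R)
    {Q : Set (Rn n)} (hQ : Q ∈ F) :
    ∃ P ∈ F, Q ⊆ P ∧ ∀ P' ∈ F, P ⊆ P' → P' = P := by
  obtain ⟨cR, K, rfl⟩ := h.1 R hR
  let S : ℤ → Prop := fun j => ∃ P ∈ F, Q ⊆ P ∧ ∃ c, P = cube c ((2:ℝ) ^ j)
  obtain ⟨c0, k0, hk0⟩ := h.1 Q (hF Q hQ).1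
  have hb : ∀ z, S z → z ≤ K := by
    rintro z ⟨P, hP, -, c, rfl⟩
    have := cube_sub_le hn (two_zpow_pos K) (hF _ hP).2
    exact (zpow_le_zpow_iff_right₀ (by norm_num)).1 this
  obtain ⟨j, ⟨P, hP, hQP, c, hc⟩, hmax⟩ :=
    Int.exists_greatest_of_bdd (P := S) ⟨K, hb⟩ ⟨k0, Q, hQ, subset_rfl, c0, hk0⟩
  refine ⟨P, hP, hQP, fun P' hP' hPP' => ?_⟩
  obtain ⟨c', j', hc'⟩ := h.1 P' (hF P' hP').1
  have h1 : j' ≤ j := hmax j' ⟨P', hP', hQP.trans hPP', c', hc'⟩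
  have h2 : j ≤ j' := by
    rw [hc, hc'] at hPP'
    exact (zpow_le_zpow_iff_right₀ (by norm_num)).1
      (cube_sub_le hn (two_zpow_pos j') hPP')
  obtain rfl : j = j' := le_antisymm h2 h1
  rw [hc, hc'] at hPP'
  rw [hc, hc']
  exact (cube_sub_eq (two_zpow_pos j) hPP').symm

lemma tsum_rpow_le {ι : Type*} (a : ι → ℝ≥0∞) {r : ℝ} (hr : 1 ≤ r) :
    ∑' i, a i ^ r ≤ (∑' i, a i) ^ r := by
  have key : ∀ x : ℝ≥0∞, x ^ r = x * x ^ (r - 1) := fun x => by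
    conv_lhs => rw [show r = 1 + (r - 1) by ring]
    rw [ENNReal.rpow_add_of_nonneg _ _ (by norm_num) (by linarith), ENNReal.rpow_one]
  calc ∑' i, a i ^ r ≤ ∑' i, a i * (∑' j, a j) ^ (r - 1) := by
        refine ENNReal.tsum_le_tsum fun i => ?_
        rw [key]
        gcongr
        exact ENNReal.le_tsum i
    _ = _ := by rw [ENNReal.tsum_mul_right, key (∑' i, a i)]

lemma geom_sum (s : ℝ) (hs : 0 < s) : ∃ C : ℝ≥0∞, C ≠ ∞ ∧ ∀ y : ℝ≥0∞,
    ∑' k : ℤ, (if (2:ℝ≥0∞) ^ k < y then ((2:ℝ≥0∞) ^ k) ^ s else 0) ≤ C * y ^ s := by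
  have h2s : (1:ℝ≥0∞) < 2 ^ s := ENNReal.one_lt_rpow (by norm_num) hs
  refine ⟨(1 - ((2:ℝ≥0∞) ^ s)⁻¹)⁻¹, ?_, fun y => ?_⟩
  · rw [Ne, ENNReal.inv_eq_top, tsub_eq_zero_iff_le, not_le]
    exact ENNReal.inv_lt_one.2 h2s
  have hC0 : (1 - ((2:ℝ≥0∞) ^ s)⁻¹)⁻¹ ≠ 0 := by
    rw [Ne, ENNReal.inv_eq_zero]
    exact ne_of_lt (lt_of_le_of_lt tsub_le_self ENNReal.one_lt_top)
  by_cases hy0 : y = 0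
  · subst hy0; simp
  by_cases hyt : y = ∞
  · subst hyt
    rw [ENNReal.top_rpow_of_pos hs, ENNReal.mul_top hC0]; exact le_top
  obtain ⟨K, hK1, hK2⟩ := ENNReal.exists_mem_Ioc_zpow hy0 hyt (y := 2) (by norm_num) (by norm_num)
  have hinj : Function.Injective (fun j : ℕ => K - (j : ℤ)) := fun a b hab => by
    simp only at hab; omega
  rw [← hinj.tsum_eq]
  · calc ∑' j : ℕ, (if (2:ℝ≥0∞) ^ (K - (j:ℤ)) < y then ((2:ℝ≥0∞) ^ (K - (j:ℤ))) ^ s else 0)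
        ≤ ∑' j : ℕ, y ^ s * (((2:ℝ≥0∞) ^ s)⁻¹) ^ j := by
          refine ENNReal.tsum_le_tsum fun j => ?_
          split_ifs
          · rw [ENNReal.zpow_sub (by norm_num) (by norm_num), zpow_natCast,
              ENNReal.mul_rpow_of_nonneg _ _ hs.le, ENNReal.inv_rpow, ← ENNReal.inv_pow]
            have : ((2:ℝ≥0∞) ^ j) ^ s = (2 ^ s) ^ j := by
              rw [← ENNReal.rpow_natCast, ← ENNReal.rpow_natCast, ← ENNReal.rpow_mul,
                ← ENNReal.rpow_mul, mul_comm]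
            rw [this]
            gcongr
          · exact zero_le
      _ = _ := by rw [ENNReal.tsum_mul_left, ENNReal.tsum_geometric, mul_comm]
  · intro k hk
    simp only [Function.mem_support, ne_eq, ite_eq_right_iff, Classical.not_imp] at hk
    have hkK : k < K + 1 := by
      by_contra hcon
      push Not at hcon
      have := ENNReal.zpow_le_of_le (x := 2) (by norm_num) hcon
      exact absurd (hk.1.trans_le hK2) (not_lt.2 this)
    exact ⟨(K - k).toNat, by simp only; omega⟩

/-- Approximating an integral by dyadic multiples of the mass. -/
lemma dyadic_approx {a s I T : ℝ≥0∞} (hs : s ≠ ∞) (hsI : s = 0 → I = 0)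
    (h : ∀ k : ℤ, (2:ℝ≥0∞) ^ (k + 1) * s < I → a * ((2:ℝ≥0∞) ^ (k + 2) * s) ≤ T) :
    a * I ≤ T := by
  by_cases hs0 : s = 0
  · rw [hsI hs0]; simp
  by_cases hI0 : I = 0
  · rw [hI0]; simp
  by_cases hIt : I = ∞
  · subst hIt
    by_cases ha : a = 0
    · simp [ha]
    have hall : ∀ k : ℕ, a * s * k ≤ T := fun k => by
      refine le_trans ?_ (h (k - 2) ?_)
      · have : (k:ℝ≥0∞) ≤ 2 ^ k := by exact_mod_cast Nat.lt_two_pow_self.le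
        rw [sub_add_cancel, zpow_natCast, mul_assoc, mul_comm s]
        gcongr
      · exact ENNReal.mul_lt_top (ENNReal.zpow_lt_top (by norm_num) (by norm_num) _)
          (lt_top_iff_ne_top.2 hs)
    have hT : T = ∞ := by
      have h1 : ⨆ k : ℕ, a * s * (k:ℝ≥0∞) ≤ T := iSup_le hall
      rw [← ENNReal.mul_iSup, ENNReal.iSup_natCast, ENNReal.mul_top (mul_ne_zero ha hs0)] at h1
      exact top_le_iff.1 h1
    rw [hT]; exact le_top
  obtain ⟨K, hK1, hK2⟩ := ENNReal.exists_mem_Ioc_zpow (x := I / s)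
    (ENNReal.div_pos hI0 hs).ne' (ENNReal.div_lt_top hIt hs0).ne (y := 2)
    (by norm_num) (by norm_num)
  refine le_trans ?_ (h (K - 1) ?_)
  · gcongr
    rw [show K - 1 + 2 = K + 1 by ring]
    exact (ENNReal.div_le_iff hs0 hs).1 hK2
  · rw [show K - 1 + 1 = K by ring]
    exact (ENNReal.lt_div_iff_mul_lt (Or.inl hs0) (Or.inl hs)).1 hK1

lemma meas_mul_fun {n : ℕ} {f g : Rn n → ℝ≥0∞} (hf : Measurable f) (hg : Measurable g) :
    Measurable (fun x => f x * g x) := hf.mul hg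

lemma maximal_sum (p : ℝ) (hp : 1 < p) : ∃ C : ℝ≥0∞, C ≠ ∞ ∧
    ∀ (n : ℕ) (σ f : Rn n → ℝ≥0∞), Measurable σ → Measurable f →
    ∀ M : ℤ → Set (Set (Rn n)), (∀ k, (M k).Countable) → (∀ k, (M k).PairwiseDisjoint id) →
    (∀ k, ∀ Q ∈ M k, MeasurableSet Q ∧ wtI σ Q ≠ ∞ ∧
      (2:ℝ≥0∞) ^ (k + 1) * wtI σ Q < ∫⁻ x in Q, f x * σ x) →
    ∑' k : ℤ, ∑' Q : M k, ((2:ℝ≥0∞) ^ (k + 2)) ^ p * wtI σ (Q : Set (Rn n))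
      ≤ C * ∫⁻ x, f x ^ p * σ x := by
  obtain ⟨C, hC, hgeom⟩ := geom_sum (p - 1) (by linarith)
  refine ⟨4 ^ p * C, ENNReal.mul_ne_top
    (ENNReal.rpow_ne_top_of_nonneg (by linarith) (by norm_num)) hC, ?_⟩
  intro n σ f hσ hf M hMc hMd hM
  have key : ∀ x : ℝ≥0∞, x ^ p = x * x ^ (p - 1) := fun x => by
    conv_lhs => rw [show p = 1 + (p - 1) by ring]
    rw [ENNReal.rpow_add_of_nonneg _ _ (by norm_num) (by linarith), ENNReal.rpow_one]
  let g : ℤ → Rn n → ℝ≥0∞ := fun k x => if (2:ℝ≥0∞) ^ k < f x then f x else 0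
  have hg : ∀ k, Measurable (g k) := fun k =>
    Measurable.ite (measurableSet_lt measurable_const hf) hf measurable_const
  have h1 : ∀ k, ∀ Q ∈ M k, (2:ℝ≥0∞) ^ k * wtI σ Q ≤ ∫⁻ x in Q, g k x * σ x := by
    intro k Q hQ
    obtain ⟨hQm, hfin, hlt⟩ := hM k Q hQ
    have hle : ∫⁻ x in Q, f x * σ x ≤ (∫⁻ x in Q, g k x * σ x) + 2 ^ k * wtI σ Q := by
      rw [wtI, ← lintegral_const_mul _ hσ, ← lintegral_add_left (meas_mul_fun (hg k) hσ)]
      refine lintegral_mono fun x => ?_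
      simp only [g]
      split_ifs with hx
      · exact le_self_add
      · rw [zero_mul, zero_add]
        gcongr
        exact not_lt.1 hx
    have h2 : (2:ℝ≥0∞) ^ (k + 1) * wtI σ Q = 2 ^ k * wtI σ Q + 2 ^ k * wtI σ Q := by
      rw [ENNReal.zpow_add (by norm_num) (by norm_num), zpow_one]; ring
    have h3 := hlt.le.trans hle
    rw [h2] at h3
    exact ENNReal.le_of_add_le_add_right
      (ENNReal.mul_ne_top (ENNReal.zpow_lt_top (by norm_num) (by norm_num) _).ne hfin) h3
  have h2 : ∀ k, ∑' Q : M k, (2:ℝ≥0∞) ^ k * wtI σ (Q : Set (Rn n)) ≤ ∫⁻ x, g k x * σ x := by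
    intro k
    have := (hMc k).to_subtype
    calc ∑' Q : M k, (2:ℝ≥0∞) ^ k * wtI σ (Q : Set (Rn n))
        ≤ ∑' Q : M k, ∫⁻ x in (Q : Set (Rn n)), g k x * σ x :=
          ENNReal.tsum_le_tsum fun Q => h1 k Q Q.2
      _ = ∫⁻ x in ⋃ Q : M k, (Q : Set (Rn n)), g k x * σ x := by
          rw [lintegral_iUnion (fun Q : M k => (hM k Q Q.2).1)]
          intro A B hAB
          exact hMd k A.2 B.2 (fun h => hAB (Subtype.ext h))
      _ ≤ _ := setLIntegral_le_lintegral _ _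
  have h3 : ∀ k : ℤ, ∀ s : ℝ≥0∞, ((2:ℝ≥0∞) ^ (k + 2)) ^ p * s
      = 4 ^ p * (((2:ℝ≥0∞) ^ k) ^ (p - 1) * (2 ^ k * s)) := by
    intro k s
    have : (2:ℝ≥0∞) ^ (k + 2) = 4 * 2 ^ k := by
      rw [ENNReal.zpow_add (by norm_num) (by norm_num), mul_comm]
      congr 1
      norm_cast
    rw [this, ENNReal.mul_rpow_of_nonneg _ _ (by linarith), key (2 ^ k)]
    ring
  calc ∑' k : ℤ, ∑' Q : M k, ((2:ℝ≥0∞) ^ (k + 2)) ^ p * wtI σ (Q : Set (Rn n))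
      = 4 ^ p * ∑' k : ℤ, ((2:ℝ≥0∞) ^ k) ^ (p - 1) *
          ∑' Q : M k, (2:ℝ≥0∞) ^ k * wtI σ (Q : Set (Rn n)) := by
        rw [← ENNReal.tsum_mul_left]
        congr 1; funext k
        rw [← ENNReal.tsum_mul_left, ← ENNReal.tsum_mul_left]
        congr 1; funext Q
        exact h3 _ _
    _ ≤ 4 ^ p * ∑' k : ℤ, ((2:ℝ≥0∞) ^ k) ^ (p - 1) * ∫⁻ x, g k x * σ x := by
        gcongr with k
        exact h2 k
    _ = 4 ^ p * ∫⁻ x, ∑' k : ℤ, ((2:ℝ≥0∞) ^ k) ^ (p - 1) * (g k x * σ x) := by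
        rw [lintegral_tsum (fun k => (meas_mul_fun measurable_const (meas_mul_fun (hg k) hσ)).aemeasurable)]
        congr 2; funext k
        rw [lintegral_const_mul _ (meas_mul_fun (hg k) hσ)]
    _ ≤ 4 ^ p * ∫⁻ x, C * (f x ^ p * σ x) := by
        gcongr with x
        calc ∑' k : ℤ, ((2:ℝ≥0∞) ^ k) ^ (p - 1) * (g k x * σ x)
            = (f x * σ x) * ∑' k : ℤ,
                (if (2:ℝ≥0∞) ^ k < f x then ((2:ℝ≥0∞) ^ k) ^ (p - 1) else 0) := by
              rw [← ENNReal.tsum_mul_left]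
              congr 1; funext k
              simp only [g]
              split_ifs <;> ring
          _ ≤ (f x * σ x) * (C * f x ^ (p - 1)) := by gcongr; exact hgeom _
          _ = _ := by rw [key]; ring
    _ = _ := by rw [lintegral_const_mul _ (meas_mul_fun (hf.pow_const p) hσ), mul_assoc]

lemma sawyer_test (n : ℕ) (α p₁ p₂ q : ℝ) (hp₁ : 0 < p₁) (hp₂ : 0 < p₂) (hq : 0 < q)
    (σ₁ σ₂ v : Rn n → ℝ≥0∞)
    (h1 : ∀ (c : Rn n) (l : ℝ), wtI σ₁ (cube c l) ≠ ∞)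
    (h2 : ∀ (c : Rn n) (l : ℝ), wtI σ₂ (cube c l) ≠ ∞)
    (hS : sawyer2 n α p₁ p₂ q σ₁ σ₂ v ≠ ∞) (c : Rn n) (l : ℝ) (hl : 0 < l) :
    ∫⁻ x in cube c l,
        M2 n α ((cube c l).indicator σ₁) ((cube c l).indicator σ₂) x ^ q * v x
      ≤ (sawyer2 n α p₁ p₂ q σ₁ σ₂ v *
        (wtI σ₁ (cube c l) ^ (1/p₁) * wtI σ₂ (cube c l) ^ (1/p₂))) ^ q := by
  have hle : (∫⁻ x in cube c l,
        M2 n α ((cube c l).indicator σ₁) ((cube c l).indicator σ₂) x ^ q * v x) ^ (1/q) /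
      (wtI σ₁ (cube c l) ^ (1/p₁) * wtI σ₂ (cube c l) ^ (1/p₂))
      ≤ sawyer2 n α p₁ p₂ q σ₁ σ₂ v := by
    unfold sawyer2
    exact le_iSup_of_le c (le_iSup_of_le l (le_iSup_of_le hl le_rfl))
  have hb : wtI σ₁ (cube c l) ^ (1/p₁) * wtI σ₂ (cube c l) ^ (1/p₂) ≠ ∞ :=
    ENNReal.mul_ne_top (ENNReal.rpow_ne_top_of_nonneg (by positivity) (h1 c l))
      (ENNReal.rpow_ne_top_of_nonneg (by positivity) (h2 c l))
  have h := (ENNReal.div_le_iff_le_mul (Or.inr hS) (Or.inl hb)).1 hle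
  rw [one_div, ENNReal.rpow_inv_le_iff hq] at h
  exact h

lemma M2D_measurable {n : ℕ} (α : ℝ) {𝒟 : Set (Set (Rn n))} (h : IsDyadicGrid 𝒟)
    (g₁ g₂ : Rn n → ℝ≥0∞) : Measurable (M2D n α 𝒟 g₁ g₂) := by
  classical
  have : M2D n α 𝒟 g₁ g₂ = fun x => ⨆ Q ∈ 𝒟, Q.indicator (fun _ =>
      (volume Q ^ (-(1 - α / (2 * (n : ℝ)))) * ∫⁻ y in Q, g₁ y) *
      (volume Q ^ (-(1 - α / (2 * (n : ℝ)))) * ∫⁻ y in Q, g₂ y)) x := by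
    funext x
    unfold M2D
    refine iSup_congr fun Q => iSup_congr fun hQ => ?_
    by_cases hx : x ∈ Q <;> simp [hx]
  rw [this]
  exact Measurable.biSup 𝒟 (grid_countable h)
    (fun Q hQ => measurable_const.indicator (grid_meas h hQ))

lemma M2D_le_M2 {n : ℕ} (α : ℝ) {𝒟 : Set (Set (Rn n))} (h : IsDyadicGrid 𝒟)
    (g₁ g₂ : Rn n → ℝ≥0∞) (x : Rn n) : M2D n α 𝒟 g₁ g₂ x ≤ M2 n α g₁ g₂ x := by
  unfold M2D
  refine iSup_le fun Q => iSup_le fun hQ => iSup_le fun hx => ?_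
  obtain ⟨c, k, rfl⟩ := h.1 Q hQ
  unfold M2
  exact le_iSup_of_le c (le_iSup_of_le _ (le_iSup_of_le (two_zpow_pos k)
    (le_iSup_of_le hx le_rfl)))

/-- Reduction of the dyadic maximal function localized to `R` to subcubes of `R`. -/
lemma M2D_local {n : ℕ} (hn : 0 < n) (α : ℝ) (hα : α < 2 * n) {𝒟 : Set (Set (Rn n))}
    (h : IsDyadicGrid 𝒟) {R : Set (Rn n)} (hR : R ∈ 𝒟) (σ₁ g : Rn n → ℝ≥0∞)
    (hg : ∀ x ∉ R, g x = 0) {x : Rn n} (hx : x ∈ R) {T : ℝ≥0∞}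
    (hT : ∀ Q ∈ 𝒟, Q ⊆ R → x ∈ Q →
      (volume Q ^ (-(1 - α / (2 * (n : ℝ)))) * ∫⁻ y in Q, σ₁ y) *
      (volume Q ^ (-(1 - α / (2 * (n : ℝ)))) * ∫⁻ y in Q, g y) ≤ T) :
    M2D n α 𝒟 (R.indicator σ₁) g x ≤ T := by
  have he : 0 < 1 - α / (2 * (n : ℝ)) := by
    have : (0:ℝ) < n := by exact_mod_cast hn
    rw [sub_pos, div_lt_one (by positivity)]
    exact hα
  have hRm := grid_meas h hR
  unfold M2D
  refine iSup_le fun Q => iSup_le fun hQ => iSup_le fun hxQ => ?_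
  rcases grid_same h hQ hR hxQ hx with hs | hs
  · refine le_trans ?_ (hT Q hQ hs hxQ)
    gcongr with y
    exact indicator_le_self _ _ _
  · refine le_trans ?_ (hT R hR subset_rfl hx)
    have hv : volume Q ^ (-(1 - α / (2 * (n : ℝ)))) ≤ volume R ^ (-(1 - α / (2 * (n : ℝ)))) := by
      rw [ENNReal.rpow_neg, ENNReal.rpow_neg]
      exact ENNReal.inv_le_inv.2 (ENNReal.rpow_le_rpow (measure_mono hs) he.le)
    have h1 : ∫⁻ y in Q, R.indicator σ₁ y ≤ ∫⁻ y in R, σ₁ y := by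
      rw [← lintegral_indicator hRm]
      exact setLIntegral_le_lintegral _ _
    have h2 : ∫⁻ y in Q, g y ≤ ∫⁻ y in R, g y := by
      rw [← lintegral_indicator hRm]
      refine (setLIntegral_le_lintegral _ _).trans (lintegral_mono fun y => ?_)
      by_cases hy : y ∈ R
      · simp [hy]
      · simp [hg y hy]
    gcongr

/-- Lemma 3.1: local testing estimate for the bilinear dyadic
fractional maximal operator. -/
theorem stmt9 (n : ℕ) (hn : 0 < n) (α p₁ p₂ p q : ℝ)
    (hα0 : 0 ≤ α) (hα : α < 2 * n) (hp₁ : 1 < p₁) (hp₂ : 1 < p₂)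
    (hp : 1/p = 1/p₁ + 1/p₂) (hq : 1/q = 1/p - α/n) (hqp₂ : p₂ ≤ q) :
    ∃ C : ℝ≥0∞, C ≠ ∞ ∧
      ∀ (w₁ w₂ v σ₁ σ₂ : Rn n → ℝ≥0∞),
        Measurable w₁ → Measurable w₂ → Measurable v →
        σ₁ = (fun x => w₁ x ^ (1 - p₁/(p₁-1))) →
        σ₂ = (fun x => w₂ x ^ (1 - p₂/(p₂-1))) →
        (∀ (c : Rn n) (l : ℝ), wtI σ₁ (cube c l) ≠ ∞) →
        (∀ (c : Rn n) (l : ℝ), wtI σ₂ (cube c l) ≠ ∞) →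
        (∀ (c : Rn n) (l : ℝ), wtI v (cube c l) ≠ ∞) →
        sawyer2 n α p₁ p₂ q σ₁ σ₂ v ≠ ∞ →
        ∀ (𝒟 : Set (Set (Rn n))), IsDyadicGrid 𝒟 →
        ∀ R ∈ 𝒟, ∀ f : Rn n → ℝ≥0∞, Measurable f → (∀ x ∉ R, f x = 0) →
          (∫⁻ x in R,
              M2D n α 𝒟 (R.indicator σ₁) (fun y => f y * σ₂ y) x ^ q * v x) ^ (1/q)
            ≤ C * sawyer2 n α p₁ p₂ q σ₁ σ₂ v * wtI σ₁ R ^ (1/p₁) *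
              (∫⁻ x, f x ^ p₂ * σ₂ x) ^ (1/p₂) := by
  have hp₁0 : 0 < p₁ := by linarith
  have hp₂0 : 0 < p₂ := by linarith
  have hq0 : 0 < q := by linarith
  obtain ⟨C, hC, hmax⟩ := maximal_sum p₂ hp₂
  refine ⟨C ^ (1/p₂), ENNReal.rpow_ne_top_of_nonneg (by positivity) hC, ?_⟩
  intro w₁ w₂ v σ₁ σ₂ hw₁ hw₂ hv hσ₁ hσ₂ hf₁ hf₂ hfv hS 𝒟 h𝒟 R hR f hf hfR
  have hmσ₁ : Measurable σ₁ := by rw [hσ₁]; exact hw₁.pow_const _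
  have hmσ₂ : Measurable σ₂ := by rw [hσ₂]; exact hw₂.pow_const _
  clear hσ₁ hσ₂ hw₁ hw₂
  set S := sawyer2 n α p₁ p₂ q σ₁ σ₂ v with hSdef
  let F : ℤ → Set (Set (Rn n)) := fun k =>
    {Q | (Q ∈ 𝒟 ∧ Q ⊆ R) ∧ (2:ℝ≥0∞) ^ (k + 1) * wtI σ₂ Q < ∫⁻ x in Q, f x * σ₂ x}
  let M : ℤ → Set (Set (Rn n)) := fun k => {P | P ∈ F k ∧ ∀ P' ∈ F k, P ⊆ P' → P' = P}
  have hM𝒟 : ∀ k, M k ⊆ 𝒟 := fun k P hP => hP.1.1.1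
  have hMc : ∀ k, (M k).Countable := fun k => (grid_countable h𝒟).mono (hM𝒟 k)
  have hfin₂ : ∀ Q ∈ 𝒟, wtI σ₂ Q ≠ ∞ := fun Q hQ => by
    obtain ⟨c, k, rfl⟩ := h𝒟.1 Q hQ; exact hf₂ _ _
  have hMd : ∀ k, (M k).PairwiseDisjoint id := by
    intro k A hA B hB hAB
    rw [Function.onFun, Set.disjoint_left]
    intro x hxA hxB
    rcases grid_same h𝒟 (hM𝒟 k hA) (hM𝒟 k hB) hxA hxB with hs | hs
    · exact hAB (hA.2 B hB.1 hs).symm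
    · exact hAB (hB.2 A hA.1 hs)
  have hsum := hmax n σ₂ f hmσ₂ hf M hMc hMd
    (fun k Q hQ => ⟨grid_meas h𝒟 (hM𝒟 k hQ), hfin₂ Q (hM𝒟 k hQ), hQ.1.2⟩)
  let G : Set (Rn n) → Rn n → ℝ≥0∞ := fun Q => M2D n α 𝒟 (Q.indicator σ₁) (Q.indicator σ₂)
  have hGm : ∀ Q, Measurable (G Q) := fun Q => M2D_measurable α h𝒟 _ _
  have hGtest : ∀ Q ∈ 𝒟, Q ⊆ R → ∫⁻ x in Q, G Q x ^ q * v x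
      ≤ (S * (wtI σ₁ R ^ (1/p₁) * wtI σ₂ Q ^ (1/p₂))) ^ q := by
    intro Q hQ hQR
    have hmono : wtI σ₁ Q ≤ wtI σ₁ R := lintegral_mono_set hQR
    obtain ⟨c, k, rfl⟩ := h𝒟.1 Q hQ
    calc ∫⁻ x in cube c (2 ^ k), G (cube c (2 ^ k)) x ^ q * v x
        ≤ ∫⁻ x in cube c (2 ^ k), M2 n α ((cube c (2 ^ k)).indicator σ₁)
            ((cube c (2 ^ k)).indicator σ₂) x ^ q * v x := by
          refine lintegral_mono fun x => ?_
          gcongr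
          exact M2D_le_M2 α h𝒟 _ _ x
      _ ≤ _ := sawyer_test n α p₁ p₂ q hp₁0 hp₂0 hq0 σ₁ σ₂ v hf₁ hf₂ hS c _ (two_zpow_pos k)
      _ ≤ _ := by gcongr
  let ι := Σ k : ℤ, M k
  have : ∀ k, Countable (M k) := fun k => (hMc k).to_subtype
  let H : ι → Rn n → ℝ≥0∞ := fun i =>
    (i.2 : Set (Rn n)).indicator (fun x => ((2:ℝ≥0∞) ^ (i.1 + 2)) ^ q * (G i.2 x) ^ q)
  have hHm : ∀ i, Measurable (H i) := fun i =>
    (((hGm _).pow_const q).const_mul _).indicator (grid_meas h𝒟 (hM𝒟 i.1 i.2.2))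
  have hpoint : ∀ x ∈ R,
      M2D n α 𝒟 (R.indicator σ₁) (fun y => f y * σ₂ y) x ^ q ≤ ∑' i, H i x := by
    intro x hx
    rw [← ENNReal.le_rpow_inv_iff hq0]
    refine M2D_local hn α hα h𝒟 hR σ₁ _ (fun y hy => by simp [hfR y hy]) hx ?_
    intro Q hQ hQR hxQ
    set V := volume Q ^ (-(1 - α / (2 * (n : ℝ)))) with hV
    rw [← mul_assoc]
    refine dyadic_approx (s := wtI σ₂ Q) (hfin₂ Q hQ) ?_ ?_
    · intro h0
      have h1 : σ₂ =ᵐ[volume.restrict Q] 0 := (lintegral_eq_zero_iff hmσ₂).1 h0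
      rw [lintegral_eq_zero_iff (meas_mul_fun hf hmσ₂)]
      filter_upwards [h1] with y hy
      simp [hy]
    · intro k hk
      obtain ⟨P, hPF, hQP, hPm⟩ := exists_maximal_cube hn h𝒟 hR (F := F k)
        (fun Q hQ => hQ.1) (Q := Q) ⟨⟨hQ, hQR⟩, hk⟩
      let i : ι := ⟨k, ⟨P, hPF, hPm⟩⟩
      have hG : V * wtI σ₁ Q * (V * wtI σ₂ Q) ≤ G P x := by
        have hind : ∀ σ : Rn n → ℝ≥0∞, ∫⁻ y in Q, P.indicator σ y = wtI σ Q := fun σ =>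
          setLIntegral_congr_fun (grid_meas h𝒟 hQ) (fun y hy => indicator_of_mem (hQP hy) σ)
        simp only [G]
        unfold M2D
        refine le_iSup_of_le Q (le_iSup_of_le hQ (le_iSup_of_le hxQ ?_))
        rw [hind, hind]
      rw [ENNReal.le_rpow_inv_iff hq0]
      refine le_trans ?_ (ENNReal.le_tsum i)
      have hxP : x ∈ (i.2 : Set (Rn n)) := hQP hxQ
      simp only [H]
      rw [indicator_of_mem hxP, ← ENNReal.mul_rpow_of_nonneg _ _ hq0.le]
      refine ENNReal.rpow_le_rpow ?_ hq0.le
      calc V * (∫⁻ y in Q, σ₁ y) * V * (2 ^ (k + 2) * wtI σ₂ Q)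
          = 2 ^ (k + 2) * (V * wtI σ₁ Q * (V * wtI σ₂ Q)) := by simp only [wtI]; ring
        _ ≤ _ := by gcongr
  have hint : ∫⁻ x in R, M2D n α 𝒟 (R.indicator σ₁) (fun y => f y * σ₂ y) x ^ q * v x
      ≤ ((S * wtI σ₁ R ^ (1/p₁)) * (C * ∫⁻ x, f x ^ p₂ * σ₂ x) ^ (1/p₂)) ^ q := by
    calc ∫⁻ x in R, M2D n α 𝒟 (R.indicator σ₁) (fun y => f y * σ₂ y) x ^ q * v x
        ≤ ∫⁻ x in R, ∑' i, H i x * v x := by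
          refine setLIntegral_mono' (grid_meas h𝒟 hR) fun x hx => ?_
          rw [ENNReal.tsum_mul_right]
          gcongr
          exact hpoint x hx
      _ ≤ ∫⁻ x, ∑' i, H i x * v x := setLIntegral_le_lintegral _ _
      _ = ∑' i, ∫⁻ x, H i x * v x := lintegral_tsum fun i => ((hHm i).mul hv).aemeasurable
      _ ≤ ∑' i : ι, (S * wtI σ₁ R ^ (1/p₁)) ^ q *
            (((2:ℝ≥0∞) ^ (i.1 + 2)) ^ p₂ * wtI σ₂ (i.2 : Set (Rn n))) ^ (q / p₂) := by
          refine ENNReal.tsum_le_tsum fun i => ?_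
          have hi := i.2.2.1.1
          have e1 : ∀ x, H i x * v x = (i.2 : Set (Rn n)).indicator
              (fun x => ((2:ℝ≥0∞) ^ (i.1 + 2)) ^ q * ((G i.2 x) ^ q * v x)) x := fun x => by
            simp only [H]
            by_cases hx : x ∈ (i.2 : Set (Rn n))
            · simp only [indicator_of_mem hx]; ring
            · simp only [indicator_of_notMem hx, zero_mul]
          simp_rw [e1]
          rw [lintegral_indicator (grid_meas h𝒟 hi.1),
            lintegral_const_mul _ (meas_mul_fun ((hGm _).pow_const q) hv)]
          refine (mul_le_mul_right (hGtest _ hi.1 hi.2) _).trans (le_of_eq ?_)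
          have e2 : p₂ * (q / p₂) = q := by field_simp
          have e3 : 1 / p₂ * q = q / p₂ := by ring
          rw [ENNReal.mul_rpow_of_nonneg _ _ (by positivity : 0 ≤ q / p₂), ← ENNReal.rpow_mul, e2,
            ← mul_assoc S, ENNReal.mul_rpow_of_nonneg _ _ hq0.le, ← ENNReal.rpow_mul _ (1/p₂), e3]
          ring
      _ = (S * wtI σ₁ R ^ (1/p₁)) ^ q * ∑' i : ι,
            (((2:ℝ≥0∞) ^ (i.1 + 2)) ^ p₂ * wtI σ₂ (i.2 : Set (Rn n))) ^ (q / p₂) :=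
          ENNReal.tsum_mul_left
      _ ≤ (S * wtI σ₁ R ^ (1/p₁)) ^ q * (∑' i : ι,
            ((2:ℝ≥0∞) ^ (i.1 + 2)) ^ p₂ * wtI σ₂ (i.2 : Set (Rn n))) ^ (q / p₂) := by
          gcongr
          exact tsum_rpow_le _ ((one_le_div hp₂0).2 hqp₂)
      _ ≤ (S * wtI σ₁ R ^ (1/p₁)) ^ q * (C * ∫⁻ x, f x ^ p₂ * σ₂ x) ^ (q / p₂) := by
          gcongr
          rw [ENNReal.tsum_sigma']
          exact hsum
      _ = _ := by
          have e3 : 1 / p₂ * q = q / p₂ := by ring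
          rw [ENNReal.mul_rpow_of_nonneg (S * wtI σ₁ R ^ (1/p₁)) (_ ^ (1/p₂)) hq0.le, ← ENNReal.rpow_mul _ (1/p₂), e3]
  rw [one_div q, ENNReal.rpow_inv_le_iff hq0]
  refine hint.trans (le_of_eq ?_)
  congr 1
  rw [ENNReal.mul_rpow_of_nonneg _ _ (by positivity : 0 ≤ 1 / p₂)]
  ring
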